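/- arXiv:1706.07731 — 2 statements merged into one kernel-verified Lean document; each statement's English description precedes it below -/
import Mathlib

section
/- (Truncated-expectation tail lemma.) Let X be a real random variable, a > 0 and b ∈ ℝ, such that ℙ(X ≥ ξ) ≤ exp(−a·(max(ξ − b, 0))²) for every ξ ∈ ℝ. Then for every c ≥ max(b, 0): E[X·1{X ≥ c}] ≤ (c + √(π/a))·exp(−a·(max(c − b, 0))²). -/
open MeasureTheory

/-- Gaussian decay of the tail of `X` beyond `c` bounds the mean excess of `X` over `c`. -/
lemma integral_max_sub_le_of_gaussian_tail {Ω : Type*} [MeasurableSpace Ω]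
    {μ : Measure Ω} {X : Ω → ℝ} {a c K : ℝ} (ha : 0 < a)
    (hint : Integrable (fun ω => max (X ω - c) 0) μ)
    (htail : ∀ t : ℝ, 0 < t → μ.real {ω | c + t ≤ X ω} ≤ K * Real.exp (-a * t ^ 2)) :
    ∫ ω, max (X ω - c) 0 ∂μ ≤ K * (Real.sqrt (Real.pi / a) / 2) := by
  rw [hint.integral_eq_integral_meas_le (.of_forall fun ω => le_max_right _ _),
    ← integral_gaussian_Ioi a, ← integral_const_mul]
  refine integral_mono_of_nonneg (.of_forall fun t => measureReal_nonneg)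
    ((integrable_exp_neg_mul_sq ha).const_mul K).integrableOn ?_
  filter_upwards [ae_restrict_mem measurableSet_Ioi] with t ht
  have ht' : 0 < t := ht
  have hset : {ω | t ≤ max (X ω - c) 0} = {ω | c + t ≤ X ω} := by
    ext ω
    simp only [Set.mem_ofPred_eq, le_max_iff, le_sub_iff_add_le', not_le.mpr ht', or_false]
  simpa only [hset] using htail t ht'

/-- **Lemma 5** (truncated-expectation tail lemma): if
`ℙ(X ≥ ξ) ≤ exp(−a |ξ−b|₊²)` for all `ξ`, then for every `c ≥ max(b,0)`,
`E[X 1{X ≥ c}] ≤ (c + √(π/a)) exp(−a |c−b|₊²)`. -/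
theorem truncated_expectation_tail_lemma {Ω : Type*} [MeasurableSpace Ω]
    (μ : Measure Ω) [IsProbabilityMeasure μ]
    (X : Ω → ℝ) (hX : Measurable X) (a b : ℝ) (ha : 0 < a)
    (htail : ∀ ξ : ℝ, (μ {ω | ξ ≤ X ω}).toReal ≤ Real.exp (-a * max (ξ - b) 0 ^ 2))
    (c : ℝ) (hc : max b 0 ≤ c) :
    ∫ ω, (if c ≤ X ω then X ω else 0) ∂μ
      ≤ (c + Real.sqrt (Real.pi / a)) * Real.exp (-a * max (c - b) 0 ^ 2) := by
  have hb : b ≤ c := (le_max_left _ _).trans hc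
  have hc0 : 0 ≤ c := (le_max_right _ _).trans hc
  by_cases hint : Integrable (fun ω => if c ≤ X ω then X ω else 0) μ
  swap
  · rw [integral_undef hint]
    positivity
  have hS : MeasurableSet {ω | c ≤ X ω} := measurableSet_le measurable_const hX
  have hconst : Integrable ({ω | c ≤ X ω}.indicator fun _ => c) μ :=
    (integrable_const c).indicator hS
  have hexcess (ω : Ω) : max (X ω - c) 0 =
      (if c ≤ X ω then X ω else 0) - {ω | c ≤ X ω}.indicator (fun _ => c) ω := by
    by_cases h : c ≤ X ω
    · simp [h]
    · simp [h, (not_le.mp h).le]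
  have hg : Integrable (fun ω => max (X ω - c) 0) μ := by
    simp only [hexcess]
    exact hint.sub hconst
  have hmean := integral_max_sub_le_of_gaussian_tail (K := Real.exp (-a * max (c - b) 0 ^ 2))
    ha hg fun t ht => by
      refine (htail (c + t)).trans ?_
      rw [← Real.exp_add, Real.exp_le_exp, max_eq_left (by linarith), max_eq_left (by linarith)]
      nlinarith [mul_nonneg ha.le (mul_nonneg (sub_nonneg.mpr hb) ht.le)]
  have hsplit := integral_sub hint hconst
  simp only [← hexcess] at hsplit
  rw [integral_indicator_const c hS, smul_eq_mul] at hsplit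
  have hmass : μ.real {ω | c ≤ X ω} * c ≤ Real.exp (-a * max (c - b) 0 ^ 2) * c :=
    mul_le_mul_of_nonneg_right (htail c) hc0
  have hpos : 0 ≤ Real.exp (-a * max (c - b) 0 ^ 2) * Real.sqrt (Real.pi / a) := by positivity
  linarith
end

section
/- (Inductive-step integral inequality of the stabilization lemma.) Let α, β > 0, μ̄ ≥ 0, μ₂ < 0, and v ≥ μ̄, and suppose 1 + √π·α·exp(α²/(4β))/√β ≤ exp(−α·μ₂). Let Z̄ be a real random variable with cumulative distribution function F(z) = 1 − exp(−α·max(z − μ̄, 0)) (so Z̄ has density α·e^{−α(z−μ̄)} on [μ̄, ∞)). Then E[ exp(−β·(max(v − Z̄ − μ₂, 0))²) ] ≤ exp(−α·(v − μ̄)). -/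
open MeasureTheory
open ProbabilityTheory

/-- Laplace transform of the reflected and shifted Gaussian kernel, by completing the square. -/
lemma lintegral_exp_neg_mul_mul_gaussian {α β : ℝ} (hα : 0 < α) (hβ : 0 < β) (w : ℝ) :
    ∫⁻ y, ENNReal.ofReal (α * Real.exp (-(α * y)) * Real.exp (-β * (w - y) ^ 2)) =
      ENNReal.ofReal (Real.exp (-(α * w)) *
        (Real.sqrt Real.pi * α * Real.exp (α ^ 2 / (4 * β)) / Real.sqrt β)) := by
  have hsq (y : ℝ) : α * Real.exp (-(α * y)) * Real.exp (-β * (w - y) ^ 2) =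
      α * Real.exp (-(α * w)) * Real.exp (α ^ 2 / (4 * β)) *
        Real.exp (-β * (y - (w - α / (2 * β))) ^ 2) := by
    rw [mul_assoc, ← Real.exp_add, mul_assoc, mul_assoc, ← Real.exp_add, ← Real.exp_add]
    congr 2
    field_simp
    ring
  simp_rw [hsq]
  rw [← ofReal_integral_eq_lintegral_ofReal]
  · rw [integral_const_mul,
      integral_sub_right_eq_self (fun y ↦ Real.exp (-β * y ^ 2)) (w - α / (2 * β)),
      integral_gaussian, Real.sqrt_div Real.pi_pos.le]
    congr 1
    ring
  · exact ((integrable_exp_neg_mul_sq hβ).comp_sub_right _).const_mul _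
  · exact ae_of_all _ fun y ↦ by positivity

/-- The tail of the exponential distribution. -/
lemma expMeasure_Ioi {α : ℝ} (hα : 0 < α) {w : ℝ} (hw : 0 ≤ w) :
    expMeasure α (Set.Ioi w) = ENNReal.ofReal (Real.exp (-(α * w))) := by
  have := isProbabilityMeasure_expMeasure hα
  have hle : Real.exp (-(α * w)) ≤ 1 := Real.exp_le_one_iff.2 (by nlinarith)
  rw [← Set.compl_Iic, prob_compl_eq_one_sub measurableSet_Iic, ← ofReal_cdf,
    cdf_expMeasure_eq hα, if_pos hw, ← ENNReal.ofReal_one,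
    ← ENNReal.ofReal_sub _ (by linarith), sub_sub_cancel]

lemma lintegral_gaussian_posPart_expMeasure_le {α β : ℝ} (hα : 0 < α) (hβ : 0 < β) {w : ℝ}
    (hw : 0 ≤ w) :
    ∫⁻ y, ENNReal.ofReal (Real.exp (-β * max (w - y) 0 ^ 2)) ∂expMeasure α ≤
      ENNReal.ofReal (Real.exp (-(α * w)) *
        (1 + Real.sqrt Real.pi * α * Real.exp (α ^ 2 / (4 * β)) / Real.sqrt β)) := by
  have hsplit (y : ℝ) : ENNReal.ofReal (Real.exp (-β * max (w - y) 0 ^ 2)) ≤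
      (Set.Ioi w).indicator 1 y + ENNReal.ofReal (Real.exp (-β * (w - y) ^ 2)) := by
    by_cases hy : w < y
    · rw [max_eq_right (by linarith), Set.indicator_of_mem (Set.mem_Ioi.2 hy)]
      simp
    · rw [max_eq_left (by linarith)]
      exact le_add_self
  have hgauss : ∫⁻ y, ENNReal.ofReal (Real.exp (-β * (w - y) ^ 2)) ∂expMeasure α ≤
      ∫⁻ y, ENNReal.ofReal (α * Real.exp (-(α * y)) * Real.exp (-β * (w - y) ^ 2)) := by
    have hpdf : Measurable (exponentialPDF α) :=
      (measurable_exponentialPDFReal α).ennreal_ofReal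
    change ∫⁻ y, _ ∂(volume.withDensity (exponentialPDF α)) ≤ _
    rw [lintegral_withDensity_eq_lintegral_mul _ hpdf (by fun_prop)]
    refine lintegral_mono fun y ↦ ?_
    rw [Pi.mul_apply, exponentialPDF_eq, ENNReal.ofReal_mul (by positivity)]
    gcongr
    split_ifs
    · exact le_rfl
    · positivity
  calc _ ≤ ∫⁻ y, ((Set.Ioi w).indicator 1 y +
          ENNReal.ofReal (Real.exp (-β * (w - y) ^ 2))) ∂expMeasure α := lintegral_mono hsplit
    _ = expMeasure α (Set.Ioi w) +
          ∫⁻ y, ENNReal.ofReal (Real.exp (-β * (w - y) ^ 2)) ∂expMeasure α := by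
      rw [lintegral_add_right _ (by fun_prop), lintegral_indicator_one measurableSet_Ioi]
    _ ≤ _ := by
      rw [mul_add, mul_one, ENNReal.ofReal_add (by positivity) (by positivity),
        expMeasure_Ioi hα hw, ← lintegral_exp_neg_mul_mul_gaussian hα hβ]
      gcongr

/-- A random variable with the cdf of a shifted exponential is a shifted exponential. -/
lemma map_sub_eq_expMeasure {Ω : Type*} [MeasurableSpace Ω] {μ : Measure Ω}
    [IsProbabilityMeasure μ] {Z : Ω → ℝ} (hZ : Measurable Z) {α m : ℝ} (hα : 0 < α)
    (hcdf : ∀ z : ℝ, (μ {ω | Z ω ≤ z}).toReal = 1 - Real.exp (-(α * max (z - m) 0))) :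
    μ.map (fun ω ↦ Z ω - m) = expMeasure α := by
  have := isProbabilityMeasure_expMeasure hα
  have hmeas : Measurable fun ω ↦ Z ω - m := hZ.sub_const m
  have := Measure.isProbabilityMeasure_map (μ := μ) hmeas.aemeasurable
  refine Measure.eq_of_cdf _ _ (StieltjesFunction.ext fun x ↦ ?_)
  have hset : (fun ω ↦ Z ω - m) ⁻¹' Set.Iic x = {ω | Z ω ≤ x + m} := by
    ext ω
    simp
  rw [cdf_eq_real, cdf_expMeasure_eq hα, measureReal_def,
    Measure.map_apply hmeas measurableSet_Iic, hset, hcdf, add_sub_cancel_right]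
  split_ifs with hx
  · rw [max_eq_left hx]
  · rw [max_eq_right (by linarith)]
    simp

/-- The inductive-step integral inequality in the proof of the stabilization
lemma: if `Z̄` has cdf `F(z) = 1 − exp(−α |z−μ̄|₊)` then, for `v ≥ μ̄`,
`E[exp(−β |v − Z̄ − μ₂|₊²)] ≤ exp(−α (v − μ̄))`. -/
theorem stabilization_inductive_step {Ω : Type*} [MeasurableSpace Ω]
    (μ : Measure Ω) [IsProbabilityMeasure μ]
    (Z : Ω → ℝ) (hZ : Measurable Z) (α β mubar m2 v : ℝ)
    (hα : 0 < α) (hβ : 0 < β) (hmubar : 0 ≤ mubar) (hm2 : m2 < 0) (hv : mubar ≤ v)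
    (hcond : 1 + Real.sqrt Real.pi * α * Real.exp (α ^ 2 / (4 * β)) / Real.sqrt β
        ≤ Real.exp (-(α * m2)))
    (hcdf : ∀ z : ℝ, (μ {ω | Z ω ≤ z}).toReal = 1 - Real.exp (-(α * max (z - mubar) 0))) :
    ∫ ω, Real.exp (-β * max (v - Z ω - m2) 0 ^ 2) ∂μ ≤ Real.exp (-(α * (v - mubar))) := by
  have hmeas : Measurable fun ω ↦ Z ω - mubar := hZ.sub_const mubar
  have hw : 0 ≤ v - m2 - mubar := by linarith
  have hmap : ∫⁻ ω, ENNReal.ofReal (Real.exp (-β * max (v - Z ω - m2) 0 ^ 2)) ∂μ =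
      ∫⁻ y, ENNReal.ofReal (Real.exp (-β * max (v - m2 - mubar - y) 0 ^ 2)) ∂expMeasure α := by
    rw [← map_sub_eq_expMeasure hZ hα hcdf, lintegral_map (by fun_prop) hmeas]
    congr with ω
    ring_nf
  rw [integral_eq_lintegral_of_nonneg_ae (ae_of_all _ fun ω ↦ (Real.exp_pos _).le)
    (by fun_prop), hmap]
  refine ENNReal.toReal_le_of_le_ofReal (Real.exp_pos _).le
    ((lintegral_gaussian_posPart_expMeasure_le hα hβ hw).trans (ENNReal.ofReal_le_ofReal ?_))
  calc _ ≤ Real.exp (-(α * (v - m2 - mubar))) * Real.exp (-(α * m2)) := by gcongr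
    _ = Real.exp (-(α * (v - mubar))) := by
      rw [← Real.exp_add]
      ring_nf
end
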